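/- arXiv:2001.04154 — 2 statements merged into one kernel-verified Lean document; each statement's English description precedes it below -/
import Mathlib

section
/- Let M_k denote the ℂ-vector space of modular forms of weight k for SL₂(ℤ), let E₄ ∈ M₄ and E₆ ∈ M₆ be the normalized Eisenstein series (with constant term 1), and let Δ = (E₄³ − E₆²)/1728 ∈ M₁₂ be the discriminant cusp form. Let R = ⊕_{k≥0} M_k ⊗_ℂ M_k, a graded ℂ-algebra with multiplication (f⊗g)·(f'⊗g') = (ff')⊗(gg'), and let σ be the graded algebra involution of R determined by σ(f⊗g) = g⊗f. Then the fixed subalgebra R^σ is the polynomial ring ℂ[E₄⊗E₄, E₆⊗E₆, Δ⊗Δ]; that is, the three elements E₄⊗E₄, E₆⊗E₆, Δ⊗Δ are algebraically independent over ℂ and generate R^σ as a ℂ-algebra. -/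
noncomputable section

open Filter Topology

/-- The upper half-plane, as a subset of ℂ. -/
def UHP : Set ℂ := {z | 0 < z.im}

/-- A modular form of weight k for SL₂(ℤ): a holomorphic function on the upper half-plane
satisfying f((az+b)/(cz+d)) = (cz+d)^k f(z) for all integer matrices of determinant 1,
and bounded as Im z → ∞. -/
def IsMF (k : ℕ) (f : ℂ → ℂ) : Prop :=
  DifferentiableOn ℂ f UHP ∧
  (∀ a b c d : ℤ, a * d - b * c = 1 → ∀ z ∈ UHP,
      f (((a : ℂ) * z + b) / ((c : ℂ) * z + d)) = ((c : ℂ) * z + d) ^ k * f z) ∧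
  ∃ C A : ℝ, ∀ z ∈ UHP, A ≤ z.im → ‖f z‖ ≤ C

/-- The product domain ℍ × ℍ. -/
def Dom : Type := ↥UHP × ↥UHP

/-- The tensor function f ⊗ g : (τ₁, τ₂) ↦ f(τ₁)·g(τ₂). -/
def tens (f g : ℂ → ℂ) : Dom → ℂ := fun p => f p.1.1 * g p.2.1

/-- The ring R = ⊕_k M_k ⊗ M_k of symmetric-weight modular forms for SL₂(ℤ) × SL₂(ℤ),
realized as the subalgebra of functions on ℍ × ℍ generated by f ⊗ g with f, g modular
forms of the same weight. -/
def Rsym : Subalgebra ℂ (Dom → ℂ) :=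
  Algebra.adjoin ℂ {F | ∃ (k : ℕ) (f g : ℂ → ℂ), IsMF k f ∧ IsMF k g ∧ F = tens f g}

open scoped UpperHalfPlane MatrixGroups ModularForm Manifold
open UpperHalfPlane (qExpansion ofComplex)

/-- A function that is modular in the sense of `IsMF` restricts to a Mathlib modular form of
level one. -/
lemma IsMF.exists_modularForm {k : ℕ} {f : ℂ → ℂ} (hf : IsMF k f) :
    ∃ g : ModularForm 𝒮ℒ k, ∀ z : ℍ, g z = f z := by
  obtain ⟨hd, ht, C, A, hb⟩ := hf
  have hs (γ : SL(2, ℤ)) : (fun z : ℍ ↦ f z) ∣[(k : ℤ)] γ = fun z : ℍ ↦ f z := by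
    ext z
    have hdet : γ 0 0 * γ 1 1 - γ 0 1 * γ 1 0 = 1 := by
      rw [← Matrix.det_fin_two, γ.det_coe]
    have hne : (γ 1 0 : ℂ) * z + γ 1 1 ≠ 0 := by
      simpa [UpperHalfPlane.denom] using UpperHalfPlane.denom_ne_zero γ z
    have := ht _ _ _ _ hdet z z.im_pos
    rw [ModularForm.SL_slash_apply, UpperHalfPlane.coe_specialLinearGroup_apply]
    simp only [algebraMap_int_eq, eq_intCast, UpperHalfPlane.denom]
    simp [this]
    field_simp
  refine ⟨⟨⟨fun z ↦ f z, fun _ ⟨γ, hγ⟩ ↦ hγ ▸ hs γ⟩, ?_, fun {c} hc ↦ ?_⟩, fun z ↦ rfl⟩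
  · exact UpperHalfPlane.mdifferentiable_iff.mpr <| hd.congr fun z hz ↦ by
      simp [UpperHalfPlane.ofComplex_apply_of_im_pos hz]
  · rw [Subgroup.IsArithmetic.isCusp_iff_isCusp_SL2Z] at hc
    refine (OnePoint.isBoundedAt_iff_forall_SL2Z hc).mpr fun γ _ ↦ ?_
    change UpperHalfPlane.IsBoundedAtImInfty ((fun z : ℍ ↦ f z) ∣[(k : ℤ)] γ)
    rw [hs γ, UpperHalfPlane.isBoundedAtImInfty_iff]
    exact ⟨C, A, fun z hz ↦ hb z z.im_pos hz⟩

/-- The space of functions spanned by the monomials of weight `k` in `x` (of weight 4) and `y`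
(of weight 6). -/
def monomialSpan {T : Type*} (x y : T → ℂ) (k : ℕ) : Submodule ℂ (T → ℂ) :=
  Submodule.span ℂ {g | ∃ a b : ℕ, 4 * a + 6 * b = k ∧ g = x ^ a * y ^ b}

lemma mul_mem_monomialSpan {T : Type*} {x y : T → ℂ} {k : ℕ} {f : T → ℂ}
    (hf : f ∈ monomialSpan x y k) (a b : ℕ) :
    x ^ a * y ^ b * f ∈ monomialSpan x y (k + 4 * a + 6 * b) := by
  induction hf using Submodule.span_induction with
  | mem g hg =>
    obtain ⟨c, d, h, rfl⟩ := hg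
    exact Submodule.subset_span ⟨a + c, b + d, by lia, by ring⟩
  | zero => simp
  | add g h _ _ hg hh => rw [mul_add]; exact add_mem hg hh
  | smul c g _ hg => rw [mul_smul_comm]; exact Submodule.smul_mem _ _ hg

lemma exists_four_mul_add_six_mul {k : ℕ} (hk : Even k) (h : 4 ≤ k) :
    ∃ a b : ℕ, 4 * a + 6 * b = k := by
  obtain h0 | h2 : k % 4 = 0 ∨ k % 4 = 2 := by grind
  · exact ⟨k / 4, 0, by lia⟩
  · exact ⟨(k - 6) / 4, 1, by lia⟩

/-- Every level one modular form is a polynomial in the Eisenstein series `E₄` and `E₆`. -/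
theorem ModularForm.mem_monomialSpan_E₄_E₆ (k : ℕ) (f : ModularForm 𝒮ℒ k) :
    (f : ℍ → ℂ) ∈ monomialSpan (ModularForm.E₄ : ℍ → ℂ) ModularForm.E₆ k := by
  induction k using Nat.strong_induction_on with | _ k ih
  obtain hk | hk := (Nat.even_or_odd k).symm
  · simp [ModularForm.levelOne_odd_weight_eq_zero (mod_cast hk) f]
  obtain rfl | rfl | h4 : k = 0 ∨ k = 2 ∨ 4 ≤ k := by grind
  · obtain ⟨c, hc⟩ := ModularFormClass.levelOne_weight_zero_const f
    rw [hc]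
    have h1 : (1 : ℍ → ℂ) ∈ monomialSpan ModularForm.E₄ ModularForm.E₆ 0 :=
      Submodule.subset_span ⟨0, 0, rfl, by simp⟩
    convert Submodule.smul_mem _ c h1
    ext; simp
  · simp [rank_zero_iff_forall_zero.mp ModularForm.levelOne_weight_two_rank_zero f]
  obtain ⟨a, b, hab⟩ := exists_four_mul_add_six_mul hk h4
  let g : ModularForm 𝒮ℒ k :=
    ((ModularForm.E₄.pow a).mul (ModularForm.E₆.pow b)).mcast (by grind)
  have hg : (g : ℍ → ℂ) = (ModularForm.E₄ : ℍ → ℂ) ^ a * (ModularForm.E₆ : ℍ → ℂ) ^ b := by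
    simp [g]
  have hg0 : (qExpansion 1 g).coeff 0 = 1 := by
    change (qExpansion 1 ((ModularForm.E₄.pow a).mul (ModularForm.E₆.pow b))).coeff 0 = 1
    rw [ModularForm.qExpansion_mul one_pos one_mem_strictPeriods_SL,
      ModularForm.qExpansion_pow one_pos one_mem_strictPeriods_SL,
      ModularForm.qExpansion_pow one_pos one_mem_strictPeriods_SL]
    have h4 := EisensteinSeries.E_qExpansion_coeff_zero (k := 4) (by norm_num) ⟨2, rfl⟩
    have h6 := EisensteinSeries.E_qExpansion_coeff_zero (k := 6) (by norm_num) ⟨3, rfl⟩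
    simp_all
  obtain ⟨s, hs⟩ := ModularForm.sub_smul_isCuspForm f g hg0
  have hfs : (f : ℍ → ℂ) = (s : ℍ → ℂ) + (qExpansion 1 f).coeff 0 • (g : ℍ → ℂ) := by
    have : (s : ℍ → ℂ) = (f - (qExpansion 1 f).coeff 0 • g : ModularForm 𝒮ℒ k) :=
      congrArg DFunLike.coe hs
    simp [this]
  rw [hfs]
  refine add_mem ?_ (Submodule.smul_mem _ _ (Submodule.subset_span ⟨a, b, hab, hg⟩))
  by_cases h12 : k < 12
  · simp [rank_zero_iff_forall_zero.mp
      (CuspForm.rank_eq_zero_of_weight_lt_twelve (mod_cast h12)) s]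
  let h : ModularForm 𝒮ℒ (k - 12 : ℕ) := s.discriminantEquiv.mcast (by lia)
  have hh := ih (k - 12) (by lia) h
  have hsh : (s : ℍ → ℂ) = (1 / 1728 : ℂ) •
      ((ModularForm.E₄ : ℍ → ℂ) ^ 3 * (ModularForm.E₆ : ℍ → ℂ) ^ 0 * h -
        (ModularForm.E₄ : ℍ → ℂ) ^ 0 * (ModularForm.E₆ : ℍ → ℂ) ^ 2 * h) := by
    ext z
    rw [← ModularForm.discriminant_mul_discriminantEquiv_apply,
      ModularForm.discriminant_eq_E₄_cube_sub_E₆_sq]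
    simp [h]
    ring
  rw [hsh]
  refine Submodule.smul_mem _ _ (sub_mem ?_ ?_)
  · convert mul_mem_monomialSpan hh 3 0 using 2; lia
  · convert mul_mem_monomialSpan hh 0 2 using 2; lia

lemma ModularForm.tendsto_atImInfty {k : ℤ} (f : ModularForm 𝒮ℒ k) :
    Tendsto f UpperHalfPlane.atImInfty (𝓝 ((qExpansion 1 f).coeff 0)) := by
  have hper := SlashInvariantFormClass.periodic_comp_ofComplex f one_mem_strictPeriods_SL
  have han := ModularFormClass.analyticAt_cuspFunction_zero f one_pos one_mem_strictPeriods_SL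
  have h0 : (qExpansion 1 f).coeff 0 = UpperHalfPlane.cuspFunction 1 f 0 := by
    simp [UpperHalfPlane.qExpansion_coeff]
  rw [h0]
  exact (han.continuousAt.tendsto.comp (UpperHalfPlane.qParam_tendsto_atImInfty one_pos)).congr
    fun τ ↦ UpperHalfPlane.eq_cuspFunction τ one_ne_zero hper

/-- A modular form of weight less than 12 is determined by its limit along the imaginary axis. -/
lemma ModularForm.eq_of_tendsto_of_lt_twelve {k : ℤ} (hk : k < 12) {f g : ModularForm 𝒮ℒ k}
    {F : ℂ → ℂ} (hF : ∀ z : ℍ, f z = F z) (hg : (qExpansion 1 g).coeff 0 = 1)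
    (hlim : Tendsto (fun y : ℝ ↦ F (Complex.I * y)) atTop (𝓝 1)) : f = g := by
  have hy : Tendsto (fun y : ℝ ↦ ofComplex (Complex.I * y)) atTop UpperHalfPlane.atImInfty := by
    refine tendsto_comap_iff.mpr (tendsto_id.congr' ?_)
    filter_upwards [eventually_gt_atTop 0] with y hy
    simp [UpperHalfPlane.ofComplex_apply_of_im_pos, hy, UpperHalfPlane.im]
  have hf1 : (qExpansion 1 f).coeff 0 = 1 := by
    refine tendsto_nhds_unique ((f.tendsto_atImInfty.comp hy).congr' ?_) hlim
    filter_upwards [eventually_gt_atTop 0] with y hy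
    simp [UpperHalfPlane.ofComplex_apply_of_im_pos, hy, hF]
  obtain ⟨s, hs⟩ := ModularForm.sub_smul_isCuspForm f g hg
  rw [rank_zero_iff_forall_zero.mp (CuspForm.rank_eq_zero_of_weight_lt_twelve hk) s, hf1, one_smul,
    map_zero] at hs
  exact sub_eq_zero.mp hs.symm

lemma IsMF.eq_E₄ {E : ℂ → ℂ} (hE : IsMF 4 E)
    (hlim : Tendsto (fun y : ℝ ↦ E (Complex.I * y)) atTop (𝓝 1)) (z : ℍ) :
    E z = ModularForm.E₄ z := by
  obtain ⟨f, hf⟩ := hE.exists_modularForm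
  rw [← hf, ModularForm.eq_of_tendsto_of_lt_twelve (by norm_num) hf
    (EisensteinSeries.E_qExpansion_coeff_zero (k := 4) (by norm_num) ⟨2, rfl⟩) hlim]

lemma IsMF.eq_E₆ {E : ℂ → ℂ} (hE : IsMF 6 E)
    (hlim : Tendsto (fun y : ℝ ↦ E (Complex.I * y)) atTop (𝓝 1)) (z : ℍ) :
    E z = ModularForm.E₆ z := by
  obtain ⟨f, hf⟩ := hE.exists_modularForm
  rw [← hf, ModularForm.eq_of_tendsto_of_lt_twelve (by norm_num) hf
    (EisensteinSeries.E_qExpansion_coeff_zero (k := 6) (by norm_num) ⟨3, rfl⟩) hlim]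

/-- A polynomial that vanishes at infinitely many points of a polynomially parametrized curve
vanishes on the whole curve. -/
lemma MvPolynomial.aeval_curve_eq_zero_of_infinite {n : ℕ} (p : MvPolynomial (Fin n) ℂ)
    {c : ℂ → Fin n → ℂ} (v : Fin n → Polynomial ℂ) (hv : ∀ x i, (v i).eval x = c x i)
    {S : Set ℂ} (hS : S.Infinite) (h : ∀ x ∈ S, MvPolynomial.aeval (c x) p = 0) (x : ℂ) :
    MvPolynomial.aeval (c x) p = 0 := by
  have key (x : ℂ) : (MvPolynomial.aeval v p).eval x = MvPolynomial.aeval (c x) p := by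
    rw [← _root_.funext (hv x)]
    simpa using MvPolynomial.comp_aeval_apply v (Polynomial.aeval x) p
  rw [← key, Polynomial.eq_zero_of_infinite_isRoot (MvPolynomial.aeval v p)
    (hS.mono fun x hx ↦ (key x).trans (h x hx)), Polynomial.eval_zero]

lemma MvPolynomial.eq_zero_of_aeval_eq_zero {n : ℕ} {p : MvPolynomial (Fin n) ℂ}
    (h : ∀ v : Fin n → ℂ, MvPolynomial.aeval v p = 0) : p = 0 :=
  MvPolynomial.funext fun v ↦ by simpa using h v

lemma Complex.infinite_compl_zero : ({0}ᶜ : Set ℂ).Infinite :=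
  (Set.finite_singleton 0).infinite_compl

lemma infinite_range_int_add (z : ℂ) : (Set.range fun n : ℤ ↦ z + n).Infinite :=
  Set.infinite_range_of_injective fun m n h ↦ by simpa using h

lemma IsMF.apply_neg_one_div {k : ℕ} {f : ℂ → ℂ} (hf : IsMF k f) {z : ℂ} (hz : z ∈ UHP) (n : ℤ) :
    f (-1 / (z + n)) = (z + n) ^ k * f z := by
  simpa using hf.2.1 0 (-1) 1 n (by ring) z hz

lemma neg_one_div_add_int_mem_UHP {z : ℂ} (hz : z ∈ UHP) (n : ℤ) : -1 / (z + n) ∈ UHP := by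
  have hz' : 0 < z.im := hz
  have hne : z + n ≠ 0 := fun h ↦ hz'.ne' (by simpa using congrArg Complex.im h)
  have : 0 < Complex.normSq (z + n) := Complex.normSq_pos.mpr hne
  simpa [UHP, Complex.div_im, neg_div] using div_pos hz' this

/-- Modularity makes the zero locus of a polynomial relation between `E4` and `E6` stable under
weighted scaling. -/
lemma IsMF.aeval_scale_eq_zero {E4 E6 : ℂ → ℂ} (h4 : IsMF 4 E4) (h6 : IsMF 6 E6)
    {p : MvPolynomial (Fin 2) ℂ} (hp : ∀ z ∈ UHP, MvPolynomial.aeval ![E4 z, E6 z] p = 0)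
    {z : ℂ} (hz : z ∈ UHP) (l : ℂ) :
    MvPolynomial.aeval ![l ^ 4 * E4 z, l ^ 6 * E6 z] p = 0 := by
  refine MvPolynomial.aeval_curve_eq_zero_of_infinite p
    (c := fun l ↦ ![l ^ 4 * E4 z, l ^ 6 * E6 z])
    ![Polynomial.C (E4 z) * Polynomial.X ^ 4, Polynomial.C (E6 z) * Polynomial.X ^ 6]
    (fun x i ↦ by fin_cases i <;> simp <;> ring) (infinite_range_int_add z) ?_ l
  rintro _ ⟨n, rfl⟩
  simpa only [h4.apply_neg_one_div hz, h6.apply_neg_one_div hz] using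
    hp _ (neg_one_div_add_int_mem_UHP hz n)

lemma I_mul_mem_UHP {y : ℝ} (hy : 0 < y) : Complex.I * y ∈ UHP := by simpa [UHP]

/-- If `E4` and `E6` tend to 1 at the cusp and `E4 ^ 3 - E6 ^ 2` has no zeros, then
`E4 ^ 3 / E6 ^ 2` takes infinitely many values. -/
lemma infinite_cube_div_sq {E4 E6 : ℂ → ℂ}
    (h4 : Tendsto (fun y : ℝ ↦ E4 (Complex.I * y)) atTop (𝓝 1))
    (h6 : Tendsto (fun y : ℝ ↦ E6 (Complex.I * y)) atTop (𝓝 1))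
    (hne : ∀ z ∈ UHP, E4 z ^ 3 ≠ E6 z ^ 2) :
    ((fun z ↦ E4 z ^ 3 / E6 z ^ 2) '' {z ∈ UHP | E4 z ≠ 0 ∧ E6 z ≠ 0}).Infinite := by
  intro hfin
  have hlim : Tendsto (fun y : ℝ ↦ E4 (Complex.I * y) ^ 3 / E6 (Complex.I * y) ^ 2) atTop
      (𝓝 1) := by
    simpa [Pi.div_def] using (h4.pow 3).div (h6.pow 2) (by simp)
  obtain ⟨z, ⟨hz, -, hz6⟩, h1⟩ := hfin.isClosed.mem_of_tendsto hlim (by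
    filter_upwards [eventually_gt_atTop 0, h4.eventually_ne one_ne_zero,
      h6.eventually_ne one_ne_zero] with y hy hy4 hy6
    exact ⟨_, ⟨I_mul_mem_UHP hy, hy4, hy6⟩, rfl⟩)
  exact hne z hz ((div_eq_one_iff_eq (pow_ne_zero 2 hz6)).mp h1)

/-- `E4` and `E6` satisfy no polynomial relation on the upper half-plane. -/
lemma IsMF.eq_zero_of_aeval_eq_zero {E4 E6 : ℂ → ℂ} (h4 : IsMF 4 E4) (h6 : IsMF 6 E6)
    (hlim4 : Tendsto (fun y : ℝ ↦ E4 (Complex.I * y)) atTop (𝓝 1))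
    (hlim6 : Tendsto (fun y : ℝ ↦ E6 (Complex.I * y)) atTop (𝓝 1))
    (hne : ∀ z ∈ UHP, E4 z ^ 3 ≠ E6 z ^ 2)
    {p : MvPolynomial (Fin 2) ℂ} (hp : ∀ z ∈ UHP, MvPolynomial.aeval ![E4 z, E6 z] p = 0) :
    p = 0 := by
  set S := (fun z ↦ E4 z ^ 3 / E6 z ^ 2) '' {z ∈ UHP | E4 z ≠ 0 ∧ E6 z ≠ 0}
  have hS : S.Infinite := infinite_cube_div_sq hlim4 hlim6 hne
  have hcurve {x y : ℂ} (hx : x ≠ 0) (hy : y ≠ 0) (hxy : x ^ 3 / y ^ 2 ∈ S) :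
      MvPolynomial.aeval ![x, y] p = 0 := by
    obtain ⟨z, ⟨hz, hz4, hz6⟩, hs⟩ := hxy
    obtain ⟨l, hl⟩ := IsAlgClosed.exists_pow_nat_eq (y * E4 z / (E6 z * x)) (n := 2) two_pos
    have hs' : E4 z ^ 3 * y ^ 2 = x ^ 3 * E6 z ^ 2 := by
      simpa [div_eq_div_iff, hz6, hy] using hs
    have e4 : l ^ 4 * E4 z = x := by
      rw [show l ^ 4 = (l ^ 2) ^ 2 by ring, hl]
      field_simp
      linear_combination hs'
    have e6 : l ^ 6 * E6 z = y := by
      rw [show l ^ 6 = (l ^ 2) ^ 3 by ring, hl]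
      field_simp
      linear_combination hs'
    simpa only [e4, e6] using h4.aeval_scale_eq_zero h6 hp hz l
  have hline {x : ℂ} (hx : x ≠ 0) (y : ℂ) : MvPolynomial.aeval ![x, y] p = 0 := by
    have hinf : {y : ℂ | y ≠ 0 ∧ x ^ 3 / y ^ 2 ∈ S}.Infinite := by
      refine Set.Infinite.of_image (fun y ↦ x ^ 3 / y ^ 2) (hS.mono fun s hs ↦ ?_)
      have hs0 : s ≠ 0 := by
        obtain ⟨z, ⟨hz, hz4, hz6⟩, rfl⟩ := hs
        exact div_ne_zero (pow_ne_zero 3 hz4) (pow_ne_zero 2 hz6)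
      obtain ⟨y, hy⟩ := IsAlgClosed.exists_pow_nat_eq (x ^ 3 / s) (n := 2) two_pos
      have hy0 : y ≠ 0 := by
        rintro rfl
        exact div_ne_zero (pow_ne_zero 3 hx) hs0 (by rw [← hy]; simp)
      have hys : x ^ 3 / y ^ 2 = s := by
        rw [hy]; field_simp
      exact ⟨y, ⟨hy0, hys ▸ hs⟩, hys⟩
    exact MvPolynomial.aeval_curve_eq_zero_of_infinite p (c := fun y ↦ ![x, y])
      ![Polynomial.C x, Polynomial.X] (fun x i ↦ by fin_cases i <;> simp) hinf
      (fun y hy ↦ hcurve hx hy.1 hy.2) y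
  refine MvPolynomial.eq_zero_of_aeval_eq_zero fun v ↦ ?_
  rw [show v = ![v 0, v 1] by ext i; fin_cases i <;> rfl]
  exact MvPolynomial.aeval_curve_eq_zero_of_infinite p (c := fun x ↦ ![x, v 1])
    ![Polynomial.X, Polynomial.C (v 1)] (fun x i ↦ by fin_cases i <;> simp)
    Complex.infinite_compl_zero (fun x hx ↦ hline hx (v 1)) (v 0)

/-- Every triple with nonzero first two entries is of the form `(x₁x₂, y₁y₂, δ₁δ₂)` with
`δᵢ = (xᵢ³ - yᵢ²) / 1728`. -/
lemma exists_mul_eq_and_mul_disc_eq {a b : ℂ} (ha : a ≠ 0) (hb : b ≠ 0) (d : ℂ) :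
    ∃ x₁ y₁ x₂ y₂ : ℂ, x₁ * x₂ = a ∧ y₁ * y₂ = b ∧
      (x₁ ^ 3 - y₁ ^ 2) / 1728 * ((x₂ ^ 3 - y₂ ^ 2) / 1728) = d := by
  set e := -(a ^ 3 + b ^ 2 - 1728 ^ 2 * d)
  obtain ⟨r, hr⟩ := IsAlgClosed.exists_pow_nat_eq (discrim 1 e (a ^ 3 * b ^ 2)) (n := 2) two_pos
  obtain ⟨m, hm⟩ := exists_quadratic_eq_zero (a := (1 : ℂ)) one_ne_zero ⟨r, by rw [← hr]; ring⟩
  obtain ⟨s, rfl⟩ := IsAlgClosed.exists_pow_nat_eq m (n := 2) two_pos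
  have hs : s ≠ 0 := by
    rintro rfl
    simp_all
  refine ⟨a, s, 1, b / s, by simp, by field_simp, ?_⟩
  field_simp
  linear_combination -hm

/-- The algebraic independence half: a polynomial relation between `E₄ ⊗ E₄`, `E₆ ⊗ E₆` and
`Δ ⊗ Δ` can be spread out first in the left variable, then in the right one. -/
lemma IsMF.algebraicIndependent_tens {E4 E6 Δ : ℂ → ℂ} (h4 : IsMF 4 E4) (h6 : IsMF 6 E6)
    (hlim4 : Tendsto (fun y : ℝ ↦ E4 (Complex.I * y)) atTop (𝓝 1))
    (hlim6 : Tendsto (fun y : ℝ ↦ E6 (Complex.I * y)) atTop (𝓝 1))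
    (hne : ∀ z ∈ UHP, E4 z ^ 3 ≠ E6 z ^ 2) (hΔ : ∀ z, Δ z = (E4 z ^ 3 - E6 z ^ 2) / 1728) :
    AlgebraicIndependent ℂ ![tens E4 E4, tens E6 E6, tens Δ Δ] := by
  refine algebraicIndependent_iff.mpr fun P hP ↦ ?_
  let T (x₁ y₁ x₂ y₂ : ℂ) : Fin 3 → ℂ :=
    ![x₁ * x₂, y₁ * y₂, (x₁ ^ 3 - y₁ ^ 2) / 1728 * ((x₂ ^ 3 - y₂ ^ 2) / 1728)]
  have spread {x₂ y₂ : ℂ} (h : ∀ z ∈ UHP, MvPolynomial.aeval (T (E4 z) (E6 z) x₂ y₂) P = 0)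
      (x₁ y₁ : ℂ) : MvPolynomial.aeval (T x₁ y₁ x₂ y₂) P = 0 := by
    let v : Fin 3 → MvPolynomial (Fin 2) ℂ :=
      ![.X 0 * .C x₂, .X 1 * .C y₂,
        (.X 0 ^ 3 - .X 1 ^ 2) * .C (1 / 1728 * ((x₂ ^ 3 - y₂ ^ 2) / 1728))]
    have key (x y : ℂ) : MvPolynomial.aeval ![x, y] (MvPolynomial.aeval v P) =
        MvPolynomial.aeval (T x y x₂ y₂) P := by
      rw [MvPolynomial.comp_aeval_apply]
      congr 2
      ext i
      fin_cases i <;> simp [T, v]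
      ring
    rw [← key, h4.eq_zero_of_aeval_eq_zero h6 hlim4 hlim6 hne
      fun z hz ↦ (key _ _).trans (h z hz), map_zero]
  have hT (x₁ y₁ x₂ y₂ : ℂ) : T x₁ y₁ x₂ y₂ = T x₂ y₂ x₁ y₁ := by
    simp only [T, mul_comm]
  have hall (x₁ y₁ x₂ y₂ : ℂ) : MvPolynomial.aeval (T x₁ y₁ x₂ y₂) P = 0 := by
    refine spread (fun z hz ↦ ?_) x₁ y₁
    rw [hT]
    refine spread (fun w hw ↦ ?_) x₂ y₂
    refine Eq.trans ?_ (congrFun hP (⟨w, hw⟩, ⟨z, hz⟩))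
    refine Eq.trans ?_ (MvPolynomial.comp_aeval_apply
      ![tens E4 E4, tens E6 E6, tens Δ Δ] (Pi.evalAlgHom ℂ (fun _ : Dom ↦ ℂ) (⟨w, hw⟩, ⟨z, hz⟩))
      P).symm
    congr 2
    ext i
    fin_cases i
    · rfl
    · rfl
    · exact (congrArg₂ (· * ·) (hΔ w) (hΔ z)).symm
  have hgen {a b : ℂ} (ha : a ≠ 0) (hb : b ≠ 0) (d : ℂ) :
      MvPolynomial.aeval ![a, b, d] P = 0 := by
    obtain ⟨x₁, y₁, x₂, y₂, rfl, rfl, rfl⟩ := exists_mul_eq_and_mul_disc_eq ha hb d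
    exact hall x₁ y₁ x₂ y₂
  have hgen' {a : ℂ} (ha : a ≠ 0) (b d : ℂ) : MvPolynomial.aeval ![a, b, d] P = 0 :=
    MvPolynomial.aeval_curve_eq_zero_of_infinite P (c := fun b ↦ ![a, b, d])
      ![Polynomial.C a, Polynomial.X, Polynomial.C d] (fun x i ↦ by fin_cases i <;> simp)
      Complex.infinite_compl_zero (fun b hb ↦ hgen ha hb d) b
  refine MvPolynomial.eq_zero_of_aeval_eq_zero fun v ↦ ?_
  rw [show v = ![v 0, v 1, v 2] by ext i; fin_cases i <;> rfl]
  exact MvPolynomial.aeval_curve_eq_zero_of_infinite P (c := fun a ↦ ![a, v 1, v 2])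
    ![Polynomial.X, Polynomial.C (v 1), Polynomial.C (v 2)] (fun x i ↦ by fin_cases i <;> simp)
    Complex.infinite_compl_zero (fun a ha ↦ hgen' ha (v 1) (v 2)) (v 0)

lemma comp_mem_monomialSpan {T T' : Type*} {x y : T → ℂ} {k : ℕ} {f : T → ℂ}
    (hf : f ∈ monomialSpan x y k) (φ : T' → T) : f ∘ φ ∈ monomialSpan (x ∘ φ) (y ∘ φ) k := by
  induction hf using Submodule.span_induction with
  | mem g hg =>
    obtain ⟨a, b, h, rfl⟩ := hg
    exact Submodule.subset_span ⟨a, b, h, rfl⟩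
  | zero => exact zero_mem _
  | add g h _ _ hg hh => exact add_mem hg hh
  | smul c g _ hg => exact Submodule.smul_mem _ c hg

/-- The restriction of a function to the upper half-plane. -/
def restrictUHP (f : ℂ → ℂ) : UHP → ℂ := fun z ↦ f z

lemma IsMF.restrictUHP_mem_monomialSpan {E4 E6 : ℂ → ℂ} (h4 : IsMF 4 E4) (h6 : IsMF 6 E6)
    (hlim4 : Tendsto (fun y : ℝ ↦ E4 (Complex.I * y)) atTop (𝓝 1))
    (hlim6 : Tendsto (fun y : ℝ ↦ E6 (Complex.I * y)) atTop (𝓝 1))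
    {k : ℕ} {f : ℂ → ℂ} (hf : IsMF k f) :
    restrictUHP f ∈ monomialSpan (restrictUHP E4) (restrictUHP E6) k := by
  obtain ⟨g, hg⟩ := hf.exists_modularForm
  let φ (z : UHP) : ℍ := ⟨z, z.2⟩
  have e : restrictUHP f = g ∘ φ := funext fun z ↦ (hg (φ z)).symm
  have e4 : restrictUHP E4 = ModularForm.E₄ ∘ φ := funext fun z ↦ h4.eq_E₄ hlim4 (φ z)
  have e6 : restrictUHP E6 = ModularForm.E₆ ∘ φ := funext fun z ↦ h6.eq_E₆ hlim6 (φ z)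
  rw [e, e4, e6]
  exact comp_mem_monomialSpan (ModularForm.mem_monomialSpan_E₄_E₆ k g) φ

lemma IsMF.one : IsMF 0 1 :=
  ⟨differentiableOn_const 1, by simp, 1, 0, by simp⟩

lemma IsMF.mul {k l : ℕ} {f g : ℂ → ℂ} (hf : IsMF k f) (hg : IsMF l g) : IsMF (k + l) (f * g) := by
  obtain ⟨hf, hf', C, A, hfb⟩ := hf
  obtain ⟨hg, hg', D, B, hgb⟩ := hg
  refine ⟨hf.mul hg, fun a b c d h z hz ↦ ?_, C * D, max A B, fun z hz hAB ↦ ?_⟩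
  · simp only [Pi.mul_apply, hf' a b c d h z hz, hg' a b c d h z hz]
    ring
  · have h1 := hfb z hz ((le_max_left _ _).trans hAB)
    have h2 := hgb z hz ((le_max_right _ _).trans hAB)
    rw [Pi.mul_apply, norm_mul]
    exact mul_le_mul h1 h2 (norm_nonneg _) ((norm_nonneg _).trans h1)

lemma IsMF.pow {k : ℕ} {f : ℂ → ℂ} (hf : IsMF k f) (n : ℕ) : IsMF (n * k) (f ^ n) := by
  induction n with
  | zero => simpa using IsMF.one
  | succ n ih => simpa only [pow_succ, add_mul, one_mul] using ih.mul hf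

lemma tens_mem_Rsym {k : ℕ} {f g : ℂ → ℂ} (hf : IsMF k f) (hg : IsMF k g) : tens f g ∈ Rsym :=
  Algebra.subset_adjoin ⟨k, f, g, hf, hg, rfl⟩

/-- For `u` a root of a monic quadratic polynomial over `S`, the subalgebra `S + S u`. -/
def Subalgebra.quadraticExtension {R A : Type*} [CommRing R] [CommRing A] [Algebra R A]
    (S : Subalgebra R A) (u : A) (hu : ∃ b ∈ S, ∃ c ∈ S, u * u = b * u + c) : Subalgebra R A where
  carrier := {F | ∃ s ∈ S, ∃ t ∈ S, F = s + t * u}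
  algebraMap_mem' r := ⟨_, S.algebraMap_mem r, 0, S.zero_mem, by simp⟩
  add_mem' := by
    rintro _ _ ⟨s, hs, t, ht, rfl⟩ ⟨s', hs', t', ht', rfl⟩
    exact ⟨_, S.add_mem hs hs', _, S.add_mem ht ht', by ring⟩
  mul_mem' := by
    rintro _ _ ⟨s, hs, t, ht, rfl⟩ ⟨s', hs', t', ht', rfl⟩
    obtain ⟨b, hb, c, hc, h⟩ := hu
    exact ⟨_, S.add_mem (S.mul_mem hs hs') (S.mul_mem (S.mul_mem ht ht') hc), _,
      S.add_mem (S.add_mem (S.mul_mem hs ht') (S.mul_mem hs' ht))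
        (S.mul_mem (S.mul_mem ht ht') hb),
      by linear_combination t * t' * h⟩

/-- The tensor function on `ℍ × ℍ` attached to two functions on `ℍ`. -/
def tensUHP (f g : UHP → ℂ) : Dom → ℂ := fun p ↦ f p.1 * g p.2

/-- A subalgebra of functions on `ℍ × ℍ` containing the four functions `x ⊗ x`, `y ⊗ y`,
`x³ ⊗ y²` and `y² ⊗ x³` contains all tensors of polynomials in `x` and `y` of equal weight. -/
lemma tensUHP_mem_of_mem_monomialSpan {B : Subalgebra ℂ (Dom → ℂ)} {x y : UHP → ℂ}
    (hx : tensUHP x x ∈ B) (hy : tensUHP y y ∈ B) (hu : tensUHP (x ^ 3) (y ^ 2) ∈ B)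
    (hv : tensUHP (y ^ 2) (x ^ 3) ∈ B) {k : ℕ} {f g : UHP → ℂ} (hf : f ∈ monomialSpan x y k)
    (hg : g ∈ monomialSpan x y k) : tensUHP f g ∈ B := by
  induction hf using Submodule.span_induction with
  | zero => convert B.zero_mem; ext; simp [tensUHP]
  | add f f' _ _ hf hf' => convert B.add_mem hf hf'; ext; simp [tensUHP, add_mul]
  | smul r f _ hf => convert B.smul_mem hf r; ext; simp [tensUHP, mul_assoc]
  | mem f hf =>
  induction hg using Submodule.span_induction with
  | zero => convert B.zero_mem; ext; simp [tensUHP]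
  | add g g' _ _ hg hg' => convert B.add_mem hg hg'; ext; simp [tensUHP, mul_add]
  | smul r g _ hg => convert B.smul_mem hg r; ext; simp [tensUHP, mul_left_comm]
  | mem g hg =>
  obtain ⟨a, b, hab, rfl⟩ := hf
  obtain ⟨c, d, hcd, rfl⟩ := hg
  obtain hac | hca := le_total a c
  · obtain ⟨t, rfl, rfl⟩ : ∃ t, c = a + 3 * t ∧ b = d + 2 * t :=
      ⟨(c - a) / 3, by omega, by omega⟩
    convert B.mul_mem (B.mul_mem (B.pow_mem hx a) (B.pow_mem hy d)) (B.pow_mem hv t)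
    ext p
    simp only [tensUHP, Pi.mul_apply, Pi.pow_apply]
    ring
  · obtain ⟨t, rfl, rfl⟩ : ∃ t, a = c + 3 * t ∧ d = b + 2 * t :=
      ⟨(a - c) / 3, by omega, by omega⟩
    convert B.mul_mem (B.mul_mem (B.pow_mem hx c) (B.pow_mem hy b)) (B.pow_mem hu t)
    ext p
    simp only [tensUHP, Pi.mul_apply, Pi.pow_apply]
    ring

/-- The functions on `ℍ × ℍ` invariant under swapping the two variables. -/
def swapInvariants : Subalgebra ℂ (Dom → ℂ) where
  carrier := {F | ∀ p : Dom, F (p.2, p.1) = F p}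
  algebraMap_mem' _ _ := rfl
  add_mem' hF hG p := congrArg₂ (· + ·) (hF p) (hG p)
  mul_mem' hF hG p := congrArg₂ (· * ·) (hF p) (hG p)

lemma tens_self_mem_swapInvariants (f : ℂ → ℂ) : tens f f ∈ swapInvariants :=
  fun _ ↦ mul_comm _ _

lemma tens_disc_eq {E4 E6 Δ : ℂ → ℂ} (hΔ : ∀ z, Δ z = (E4 z ^ 3 - E6 z ^ 2) / 1728) :
    tens Δ Δ = (1 / 1728 ^ 2 : ℂ) • (tens E4 E4 ^ 3 + tens E6 E6 ^ 2 -
      (tens (E4 ^ 3) (E6 ^ 2) + tens (E6 ^ 2) (E4 ^ 3))) := by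
  ext p
  simp [tens, hΔ]
  ring

lemma adjoin_le_Rsym_inf_swapInvariants {E4 E6 Δ : ℂ → ℂ} (h4 : IsMF 4 E4) (h6 : IsMF 6 E6)
    (hΔ : ∀ z, Δ z = (E4 z ^ 3 - E6 z ^ 2) / 1728) :
    Algebra.adjoin ℂ (Set.range ![tens E4 E4, tens E6 E6, tens Δ Δ]) ≤ Rsym ⊓ swapInvariants := by
  have hx := tens_mem_Rsym h4 h4
  have hy := tens_mem_Rsym h6 h6
  have hd : tens Δ Δ ∈ Rsym := by
    rw [tens_disc_eq hΔ]
    exact Rsym.smul_mem (Rsym.sub_mem (Rsym.add_mem (Rsym.pow_mem hx 3) (Rsym.pow_mem hy 2))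
      (Rsym.add_mem (tens_mem_Rsym (h4.pow 3) (h6.pow 2)) (tens_mem_Rsym (h6.pow 2) (h4.pow 3)))) _
  refine Algebra.adjoin_le ?_
  rintro _ ⟨i, rfl⟩
  fin_cases i
  · exact ⟨hx, tens_self_mem_swapInvariants _⟩
  · exact ⟨hy, tens_self_mem_swapInvariants _⟩
  · exact ⟨hd, tens_self_mem_swapInvariants _⟩

/-- An element of `R` has the form `s + t (E₄³ ⊗ E₆²)` with `s` and `t` polynomials in
`E₄ ⊗ E₄`, `E₆ ⊗ E₆` and `Δ ⊗ Δ`, so it equals its symmetrization when it is invariant. -/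
lemma mem_adjoin_of_mem_Rsym_of_mem_swapInvariants {E4 E6 Δ : ℂ → ℂ} (h4 : IsMF 4 E4)
    (h6 : IsMF 6 E6) (hlim4 : Tendsto (fun y : ℝ ↦ E4 (Complex.I * y)) atTop (𝓝 1))
    (hlim6 : Tendsto (fun y : ℝ ↦ E6 (Complex.I * y)) atTop (𝓝 1))
    (hΔ : ∀ z, Δ z = (E4 z ^ 3 - E6 z ^ 2) / 1728) {F : Dom → ℂ} (hF : F ∈ Rsym)
    (hswap : F ∈ swapInvariants) :
    F ∈ Algebra.adjoin ℂ (Set.range ![tens E4 E4, tens E6 E6, tens Δ Δ]) := by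
  set S := Algebra.adjoin ℂ (Set.range ![tens E4 E4, tens E6 E6, tens Δ Δ])
  set u := tens (E4 ^ 3) (E6 ^ 2)
  set v := tens (E6 ^ 2) (E4 ^ 3)
  have hx : tens E4 E4 ∈ S := Algebra.subset_adjoin ⟨0, rfl⟩
  have hy : tens E6 E6 ∈ S := Algebra.subset_adjoin ⟨1, rfl⟩
  have hd : tens Δ Δ ∈ S := Algebra.subset_adjoin ⟨2, rfl⟩
  have huv : u + v ∈ S := by
    have : u + v = tens E4 E4 ^ 3 + tens E6 E6 ^ 2 - (1728 ^ 2 : ℂ) • tens Δ Δ := by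
      rw [tens_disc_eq hΔ, smul_smul]
      norm_num [u, v]
    rw [this]
    exact S.sub_mem (S.add_mem (S.pow_mem hx 3) (S.pow_mem hy 2)) (S.smul_mem hd _)
  have hmul : u * v = tens E4 E4 ^ 3 * tens E6 E6 ^ 2 := by
    ext p
    simp [u, v, tens]
    ring
  have hu : ∃ b ∈ S, ∃ c ∈ S, u * u = b * u + c :=
    ⟨_, huv, _, S.neg_mem (S.mul_mem (S.pow_mem hx 3) (S.pow_mem hy 2)),
      by linear_combination -hmul⟩
  set B := S.quadraticExtension u hu
  have hS {s : Dom → ℂ} (hs : s ∈ S) : s ∈ B := ⟨s, hs, 0, S.zero_mem, by simp⟩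
  have huB : u ∈ B := ⟨0, S.zero_mem, 1, S.one_mem, by simp⟩
  have hvB : v ∈ B := by simpa using B.sub_mem (hS huv) huB
  have hR : Rsym ≤ B := by
    refine Algebra.adjoin_le ?_
    rintro _ ⟨k, f, g, hf, hg, rfl⟩
    change tensUHP (restrictUHP f) (restrictUHP g) ∈ B
    have hxB : tensUHP (restrictUHP E4) (restrictUHP E4) ∈ B := hS hx
    have hyB : tensUHP (restrictUHP E6) (restrictUHP E6) ∈ B := hS hy
    have huB' : tensUHP (restrictUHP E4 ^ 3) (restrictUHP E6 ^ 2) ∈ B := huB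
    have hvB' : tensUHP (restrictUHP E6 ^ 2) (restrictUHP E4 ^ 3) ∈ B := hvB
    exact tensUHP_mem_of_mem_monomialSpan hxB hyB huB' hvB'
      (h4.restrictUHP_mem_monomialSpan h6 hlim4 hlim6 hf)
      (h4.restrictUHP_mem_monomialSpan h6 hlim4 hlim6 hg)
  obtain ⟨s, hs, t, ht, rfl⟩ := hR hF
  have hinv : S ≤ swapInvariants :=
    (adjoin_le_Rsym_inf_swapInvariants h4 h6 hΔ).trans inf_le_right
  have : s + t * u = s + (1 / 2 : ℂ) • (t * (u + v)) := by
    ext p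
    have h : s (p.2, p.1) + t (p.2, p.1) * u (p.2, p.1) = s p + t p * u p := hswap p
    have huv : u (p.2, p.1) = v p := mul_comm _ _
    rw [hinv hs p, hinv ht p, huv] at h
    simp only [Pi.add_apply, Pi.mul_apply, Pi.smul_apply, smul_eq_mul]
    linear_combination -h / 2
  rw [this]
  exact S.add_mem hs (S.smul_mem (S.mul_mem ht huv) _)

/-- If E₄ and E₆ are the normalized weight-4 and weight-6 Eisenstein series
(modular forms whose value at iy tends to 1 as y → ∞) and Δ = (E₄³ - E₆²)/1728, then the
fixed subalgebra R^σ of the swap involution σ on R = ⊕ M_k ⊗ M_k is the polynomial ring on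
the three algebraically independent elements E₄⊗E₄, E₆⊗E₆, Δ⊗Δ. -/
theorem symmetric_tensor_ring_polynomial :
    ∀ E4 E6 : ℂ → ℂ, IsMF 4 E4 → IsMF 6 E6 →
      Tendsto (fun y : ℝ => E4 (Complex.I * y)) atTop (𝓝 1) →
      Tendsto (fun y : ℝ => E6 (Complex.I * y)) atTop (𝓝 1) →
      ∀ Δ : ℂ → ℂ, (∀ z : ℂ, Δ z = (E4 z ^ 3 - E6 z ^ 2) / 1728) →
        AlgebraicIndependent ℂ ![tens E4 E4, tens E6 E6, tens Δ Δ] ∧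
        ∀ F : Dom → ℂ,
          (F ∈ Rsym ∧ ∀ p : Dom, F (p.2, p.1) = F p) ↔
            F ∈ Algebra.adjoin ℂ (Set.range ![tens E4 E4, tens E6 E6, tens Δ Δ]) := by
  intro E4 E6 h4 h6 hlim4 hlim6 Δ hΔ
  have hne (z : ℂ) (hz : z ∈ UHP) : E4 z ^ 3 ≠ E6 z ^ 2 := fun h ↦ by
    refine ModularForm.discriminant_ne_zero ⟨z, hz⟩ ?_
    rw [ModularForm.discriminant_eq_E₄_cube_sub_E₆_sq, ← h4.eq_E₄ hlim4, ← h6.eq_E₆ hlim6]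
    simp [h]
  exact ⟨h4.algebraicIndependent_tens h6 hlim4 hlim6 hne hΔ, fun F ↦
    ⟨fun ⟨hF, hswap⟩ ↦
      mem_adjoin_of_mem_Rsym_of_mem_swapInvariants h4 h6 hlim4 hlim6 hΔ hF hswap,
      fun hF ↦ adjoin_le_Rsym_inf_swapInvariants h4 h6 hΔ hF⟩⟩

end
end

section
/- Let K = ℚ(√−7) with ring of integers 𝒪_K = ℤ[(1+√−7)/2], and let λ = (1+√−7)/2 ∈ 𝒪_K, which has norm 2. If F is a Hermitian modular form for 𝒪_K (of any weight) which vanishes on the Heegner divisor ℋ₂ (i.e., F ∘ φ_λ ≡ 0), then the restriction of F to the Siegel upper half-space ℍ₂ vanishes to order ≥ 2 along the diagonal: for all τ₁, τ₂ in the complex upper half-plane, writing D = [[τ₁,0],[0,τ₂]] ∈ ℍ₂ and S = [[0,1],[1,0]], the holomorphic function t ↦ F(D + tS) vanishes to order ≥ 2 at t = 0. -/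
noncomputable section

open Matrix Filter Topology
open scoped ComplexOrder

attribute [local instance] Matrix.normedAddCommGroup Matrix.normedSpace

/-- The algebraic number (1 + √(-d))/2 = (1 + i·√d)/2 , viewed in ℂ. -/
def omg (d : ℕ) : ℂ := (1 + Complex.I * (Real.sqrt d : ℝ)) / 2

/-- The ring of integers ℤ[(1+√(-d))/2] of ℚ(√(-d)) (for d ≡ 3 mod 4), as a subset of ℂ. -/
def ringInts (d : ℕ) : Set ℂ := {z | ∃ a b : ℤ, z = (a : ℂ) + (b : ℂ) * omg d}

/-- The Hermitian upper half-space of degree two: 2×2 complex matrices τ such that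
(τ - conj(τ)ᵀ)/(2i) is positive definite. -/
def HH2 : Set (Matrix (Fin 2) (Fin 2) ℂ) :=
  {τ | (Matrix.of fun i j => (τ i j - (starRingEnd ℂ) (τ j i)) / (2 * Complex.I)).PosDef}

/-- The matrix J = [[0, -I₂],[I₂, 0]]. -/
def Jmat : Matrix (Fin 4) (Fin 4) ℂ :=
  !![0,0,-1,0; 0,0,0,-1; 1,0,0,0; 0,1,0,0]

/-- Upper-left 2×2 block. -/
def blkA (M : Matrix (Fin 4) (Fin 4) ℂ) : Matrix (Fin 2) (Fin 2) ℂ :=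
  !![M 0 0, M 0 1; M 1 0, M 1 1]
/-- Upper-right 2×2 block. -/
def blkB (M : Matrix (Fin 4) (Fin 4) ℂ) : Matrix (Fin 2) (Fin 2) ℂ :=
  !![M 0 2, M 0 3; M 1 2, M 1 3]
/-- Lower-left 2×2 block. -/
def blkC (M : Matrix (Fin 4) (Fin 4) ℂ) : Matrix (Fin 2) (Fin 2) ℂ :=
  !![M 2 0, M 2 1; M 3 0, M 3 1]
/-- Lower-right 2×2 block. -/
def blkD (M : Matrix (Fin 4) (Fin 4) ℂ) : Matrix (Fin 2) (Fin 2) ℂ :=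
  !![M 2 2, M 2 3; M 3 2, M 3 3]

/-- Membership in SU_{2,2}(𝒪_K): entries in 𝒪_K, determinant 1, and Mᵀ·J·conj(M) = J. -/
def inSU (d : ℕ) (M : Matrix (Fin 4) (Fin 4) ℂ) : Prop :=
  (∀ i j, M i j ∈ ringInts d) ∧ M.det = 1 ∧
    Mᵀ * Jmat * M.map (starRingEnd ℂ) = Jmat

/-- Möbius action M·τ = (aτ+b)(cτ+d)⁻¹. -/
def moebius (M : Matrix (Fin 4) (Fin 4) ℂ) (τ : Matrix (Fin 2) (Fin 2) ℂ) :
    Matrix (Fin 2) (Fin 2) ℂ :=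
  (blkA M * τ + blkB M) * (blkC M * τ + blkD M)⁻¹

/-- A Hermitian modular form of weight k for 𝒪_K, K = ℚ(√(-d)): a holomorphic function on
𝐇₂ satisfying F(M·τ) = det(cτ+d)^k·F(τ) for all M ∈ SU_{2,2}(𝒪_K). -/
def IsHMF (d k : ℕ) (F : Matrix (Fin 2) (Fin 2) ℂ → ℂ) : Prop :=
  DifferentiableOn ℂ F HH2 ∧
    ∀ M, inSU d M → ∀ τ ∈ HH2,
      F (moebius M τ) = (blkC M * τ + blkD M).det ^ k * F τ

/-- A symmetric Hermitian modular form: F(τᵀ) = (-1)^k F(τ). -/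
def IsSymHMF (d k : ℕ) (F : Matrix (Fin 2) (Fin 2) ℂ → ℂ) : Prop :=
  IsHMF d k F ∧ ∀ τ ∈ HH2, F τᵀ = (-1) ^ k * F τ

/-- A skew-symmetric Hermitian modular form: F(τᵀ) = -(-1)^k F(τ). -/
def IsSkewHMF (d k : ℕ) (F : Matrix (Fin 2) (Fin 2) ℂ → ℂ) : Prop :=
  IsHMF d k F ∧ ∀ τ ∈ HH2, F τᵀ = -((-1) ^ k * F τ)

/-- The embedding φ_λ of the Siegel upper half-space into 𝐇₂ given by
[[τ, z],[z, w]] ↦ [[τ, conj(λ)z],[λz, ℓw]] with ℓ = λ·conj(λ). -/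
def phiLam (lam : ℂ) (τ : Matrix (Fin 2) (Fin 2) ℂ) : Matrix (Fin 2) (Fin 2) ℂ :=
  !![τ 0 0, (starRingEnd ℂ) lam * τ 0 1;
     lam * τ 0 1, (lam * (starRingEnd ℂ) lam) * τ 1 1]

/-- Sylvester's criterion for `2 × 2` Hermitian matrices. -/
lemma posDef_fin_two {M : Matrix (Fin 2) (Fin 2) ℂ} (hM : M.IsHermitian)
    (h0 : 0 < (M 0 0).re)
    (hdet : Complex.normSq (M 0 1) < (M 0 0).re * (M 1 1).re) : M.PosDef := by
  have h00 : (M 0 0).im = 0 := Complex.conj_eq_iff_im.1 (hM.apply 0 0)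
  have h11 : (M 1 1).im = 0 := Complex.conj_eq_iff_im.1 (hM.apply 1 1)
  have h10 : M 1 0 = (starRingEnd ℂ) (M 0 1) := (hM.apply 1 0).symm
  refine .of_dotProduct_mulVec_pos hM fun x hx => ?_
  rw [Complex.normSq_apply] at hdet
  rw [Complex.pos_iff]
  simp only [dotProduct, mulVec, Fin.sum_univ_two, Pi.star_apply, h10, Complex.add_re,
    Complex.add_im, Complex.mul_re, Complex.mul_im, Complex.star_def, Complex.conj_re,
    Complex.conj_im, h00, h11]
  refine ⟨?_, by ring⟩
  set p := (M 0 0).re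
  set q := (M 1 1).re
  set r := (M 0 1).re
  set s := (M 0 1).im
  set u := (x 0).re
  set v := (x 0).im
  set e := (x 1).re
  set f := (x 1).im
  refine pos_of_mul_pos_right (a := p) ?_ h0.le
  by_cases hy : e ^ 2 + f ^ 2 = 0
  · have he0 : e = 0 := by nlinarith [sq_nonneg e, sq_nonneg f]
    have hf0 : f = 0 := by nlinarith [sq_nonneg e, sq_nonneg f]
    have huv : 0 < u ^ 2 + v ^ 2 := by
      refine lt_of_le_of_ne (by positivity) fun h => hx ?_
      have hu0 : u = 0 := by nlinarith [sq_nonneg u, sq_nonneg v]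
      have hv0 : v = 0 := by nlinarith [sq_nonneg u, sq_nonneg v]
      ext i
      fin_cases i
      · exact Complex.ext hu0 hv0
      · exact Complex.ext he0 hf0
    rw [he0, hf0]
    have := mul_pos (mul_pos h0 h0) huv
    linarith
  · have hy' : 0 < e ^ 2 + f ^ 2 := lt_of_le_of_ne (by positivity) (Ne.symm hy)
    have h1 := mul_pos (sub_pos.2 hdet) hy'
    have h2 := sq_nonneg (p * u + r * e - s * f)
    have h3 := sq_nonneg (p * v + s * e + r * f)
    linarith

/-- The Hermitian upper half-space is a neighbourhood of its diagonal points. -/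
lemma HH2_mem_nhds_diagonal {τ₁ τ₂ : ℂ} (h1 : 0 < τ₁.im) (h2 : 0 < τ₂.im) :
    HH2 ∈ 𝓝 (!![τ₁, 0; 0, τ₂] : Matrix (Fin 2) (Fin 2) ℂ) := by
  have hent : ∀ i j, Continuous fun τ : Matrix (Fin 2) (Fin 2) ℂ => τ i j :=
    fun i j => continuous_id.matrix_elem i j
  have e1 : ∀ᶠ τ : Matrix (Fin 2) (Fin 2) ℂ in 𝓝 !![τ₁, 0; 0, τ₂], 0 < (τ 0 0).im :=
    (Complex.continuous_im.comp (hent 0 0)).continuousAt.eventually_const_lt (by simpa)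
  have e2 : ∀ᶠ τ : Matrix (Fin 2) (Fin 2) ℂ in 𝓝 !![τ₁, 0; 0, τ₂],
      Complex.normSq ((τ 0 1 - (starRingEnd ℂ) (τ 1 0)) / (2 * Complex.I)) <
        (τ 0 0).im * (τ 1 1).im := by
    refine ContinuousAt.eventually_lt (Continuous.continuousAt ?_) (Continuous.continuousAt ?_) ?_
    · exact Complex.continuous_normSq.comp
        (((hent 0 1).sub (Complex.continuous_conj.comp (hent 1 0))).div_const _)
    · exact (Complex.continuous_im.comp (hent 0 0)).mul (Complex.continuous_im.comp (hent 1 1))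
    · simpa using mul_pos h1 h2
  have hdiag : ∀ z : ℂ, ((z - (starRingEnd ℂ) z) / (2 * Complex.I)) = z.im := by
    intro z
    rw [Complex.sub_conj]
    field_simp [Complex.I_ne_zero]
    push_cast
    ring
  filter_upwards [e1, e2] with τ hτ1 hτ2
  refine posDef_fin_two ?_ ?_ ?_
  · ext i j
    simp only [conjTranspose_apply, of_apply, Complex.star_def, map_div₀, map_sub, map_mul,
      Complex.conj_conj, Complex.conj_I, map_ofNat, mul_neg, div_neg, ← neg_div, neg_sub]
  · simpa [hdiag] using hτ1
  · simpa [hdiag] using hτ2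

lemma tendsto_line (A B : Matrix (Fin 2) (Fin 2) ℂ) :
    Tendsto (fun t : ℂ => A + t • B) (𝓝 0) (𝓝 A) := by
  have : Continuous fun t : ℂ => A + t • B := by fun_prop
  simpa using this.tendsto 0

/-- A Hermitian modular form transforms by `(-1) ^ k` under swapping the two coordinates. -/
lemma IsHMF.map_swap {d k : ℕ} {F : Matrix (Fin 2) (Fin 2) ℂ → ℂ} (hF : IsHMF d k F)
    {a b c e : ℂ} (h : !![a, b; c, e] ∈ HH2) :
    F !![e, c; b, a] = (-1) ^ k * F !![a, b; c, e] := by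
  let M : Matrix (Fin 4) (Fin 4) ℂ := !![0,1,0,0; 1,0,0,0; 0,0,0,1; 0,0,1,0]
  have hD : blkD M = !![0, 1; 1, 0] := by simp [blkD, M]
  have hC : blkC M = 0 := by ext i j; fin_cases i <;> fin_cases j <;> simp [blkC, M]
  have hinv : (!![0, 1; 1, 0] : Matrix (Fin 2) (Fin 2) ℂ)⁻¹ = !![0, 1; 1, 0] :=
    inv_eq_left_inv (by simp [one_fin_two])
  have hM : inSU d M := by
    refine ⟨fun i j => ?_, ?_, ?_⟩
    · have h0 : (0 : ℂ) ∈ ringInts d := ⟨0, 0, by simp⟩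
      have h1 : (1 : ℂ) ∈ ringInts d := ⟨1, 0, by simp⟩
      fin_cases i <;> fin_cases j <;> simp [M, h0, h1]
    · simp [M, det_succ_row_zero, Fin.sum_univ_succ, Fin.succAbove]
    · ext i j
      fin_cases i <;> fin_cases j <;> simp [M, Jmat, mul_apply, Fin.sum_univ_four]
  have key := hF.2 M hM _ h
  have hmoeb : moebius M !![a, b; c, e] = !![e, c; b, a] := by
    rw [moebius, hC, hD, zero_mul, zero_add, hinv]
    simp [blkA, blkB, M]
  rw [hmoeb, hC, hD, zero_mul, zero_add] at key
  simpa using key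

/-- If a function vanishes along a complex line through `A`, its derivative at `A` kills the
direction of that line. -/
lemma fderiv_apply_eq_zero_of_line {F : Matrix (Fin 2) (Fin 2) ℂ → ℂ}
    {A B : Matrix (Fin 2) (Fin 2) ℂ} (hF : DifferentiableAt ℂ F A)
    (h : ∀ᶠ t : ℂ in 𝓝 0, F (A + t • B) = 0) : fderiv ℂ F A B = 0 := by
  have h1 : HasLineDerivAt ℂ F (fderiv ℂ F A B) A B := hF.hasFDerivAt.hasLineDerivAt B
  have h2 : HasDerivAt (fun _ : ℂ => (0 : ℂ)) (fderiv ℂ F A B) 0 :=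
    HasDerivAt.congr_of_eventuallyEq h1 (h.mono fun t ht => ht.symm)
  exact h2.unique (hasDerivAt_const _ _)

lemma omg_seven_mul_conj : omg 7 * (starRingEnd ℂ) (omg 7) = 2 := by
  have h : ((Real.sqrt 7 : ℝ) : ℂ) ^ 2 = 7 := by
    rw [← Complex.ofReal_pow, Real.sq_sqrt (by norm_num)]; norm_num
  simp only [omg, map_div₀, map_add, map_mul, map_one, map_ofNat, Complex.conj_I,
    Complex.conj_ofReal, Nat.cast_ofNat]
  linear_combination (1 / 4 : ℂ) * h - (1 / 4) * ((Real.sqrt 7 : ℝ) : ℂ) ^ 2 * Complex.I_sq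

lemma omg_add_conj (d : ℕ) : omg d + (starRingEnd ℂ) (omg d) = 1 := by
  simp only [omg, map_div₀, map_add, map_mul, map_one, map_ofNat, Complex.conj_I,
    Complex.conj_ofReal]
  ring

/-- A function vanishing on `ℋ₂` vanishes on the line of `ℋ₂` through a diagonal point. -/
lemma eventually_eq_zero_on_H2_line {F : Matrix (Fin 2) (Fin 2) ℂ → ℂ}
    (hF : ∀ τ ∈ HH2, τᵀ = τ → F (phiLam (omg 7) τ) = 0) {τ₁ τ₂ : ℂ}
    (h1 : 0 < τ₁.im) (h2 : 0 < τ₂.im) :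
    ∀ᶠ t : ℂ in 𝓝 0, F !![τ₁, (starRingEnd ℂ) (omg 7) * t; omg 7 * t, τ₂] = 0 := by
  have h2' : 0 < (τ₂ / 2).im := by simpa using h2
  filter_upwards [(tendsto_line !![τ₁, 0; 0, τ₂ / 2] !![0, 1; 1, 0]).eventually
    (HH2_mem_nhds_diagonal h1 h2')] with t ht
  have := hF _ ht (by ext i j; fin_cases i <;> fin_cases j <;> simp)
  rw [phiLam, omg_seven_mul_conj] at this
  simpa [mul_div_cancel₀] using this

/-- For K = ℚ(√-7) and λ = (1+√-7)/2 of norm 2, every Hermitian modular form F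
vanishing on the Heegner divisor ℋ₂ vanishes to order ≥ 2 along the diagonal of the Siegel
upper half-space: for τ₁, τ₂ in the upper half-plane, t ↦ F([[τ₁,t],[t,τ₂]]) vanishes to
order ≥ 2 at t = 0. -/
theorem vanishing_on_H2_gives_double_diagonal_zero :
    ∀ k : ℕ, ∀ F : Matrix (Fin 2) (Fin 2) ℂ → ℂ, IsHMF 7 k F →
      (∀ τ ∈ HH2, τᵀ = τ → F (phiLam (omg 7) τ) = 0) →
      ∀ τ₁ τ₂ : ℂ, 0 < τ₁.im → 0 < τ₂.im →
        ∀ m < 2, iteratedDeriv m (fun t : ℂ => F !![τ₁, t; t, τ₂]) 0 = 0 := by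
  intro k F hF hvan τ₁ τ₂ h1 h2 m hm
  set D : Matrix (Fin 2) (Fin 2) ℂ := !![τ₁, 0; 0, τ₂] with hD
  set l := omg 7
  have hdiff : DifferentiableAt ℂ F D := hF.1.differentiableAt (HH2_mem_nhds_diagonal h1 h2)
  have line1 : ∀ᶠ t : ℂ in 𝓝 0, F (D + t • !![0, (starRingEnd ℂ) l; l, 0]) = 0 := by
    filter_upwards [eventually_eq_zero_on_H2_line hvan h1 h2] with t ht
    simpa [hD, mul_comm t] using ht
  have line2 : ∀ᶠ t : ℂ in 𝓝 0, F (D + t • !![0, l; (starRingEnd ℂ) l, 0]) = 0 := by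
    filter_upwards [eventually_eq_zero_on_H2_line hvan h2 h1,
      (tendsto_line !![τ₂, 0; 0, τ₁] !![0, (starRingEnd ℂ) l; l, 0]).eventually
        (HH2_mem_nhds_diagonal h2 h1)] with t ht hmem
    have hmem' : !![τ₂, (starRingEnd ℂ) l * t; l * t, τ₁] ∈ HH2 := by
      have heq : !![τ₂, (starRingEnd ℂ) l * t; l * t, τ₁] =
          !![τ₂, 0; 0, τ₁] + t • !![0, (starRingEnd ℂ) l; l, 0] := by
        simp [mul_comm t]
      exact heq ▸ hmem
    have hswap := hF.map_swap hmem'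
    rw [ht, mul_zero] at hswap
    simpa [hD, mul_comm t] using hswap
  have hD0 : F D = 0 := by simpa using line1.self_of_nhds
  have hS : fderiv ℂ F D !![0, 1; 1, 0] = 0 := by
    have hsum : (!![0, 1; 1, 0] : Matrix (Fin 2) (Fin 2) ℂ) =
        !![0, (starRingEnd ℂ) l; l, 0] + !![0, l; (starRingEnd ℂ) l, 0] := by
      have hl : l + (starRingEnd ℂ) l = 1 := omg_add_conj 7
      simp [hl, add_comm ((starRingEnd ℂ) l)]
    rw [hsum, map_add, fderiv_apply_eq_zero_of_line hdiff line1,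
      fderiv_apply_eq_zero_of_line hdiff line2, add_zero]
  have hfun : (fun t : ℂ => F !![τ₁, t; t, τ₂]) = fun t => F (D + t • !![0, 1; 1, 0]) := by
    funext t
    simp [hD]
  rw [hfun]
  interval_cases m
  · rw [iteratedDeriv_zero, zero_smul, add_zero, hD0]
  · rw [iteratedDeriv_one]
    have h : HasLineDerivAt ℂ F (fderiv ℂ F D !![0, 1; 1, 0]) D !![0, 1; 1, 0] :=
      hdiff.hasFDerivAt.hasLineDerivAt _
    exact (HasDerivAt.deriv h).trans hS


end
end
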